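/- Let A be a (possibly infinite) geometrically fast set of positive bump functions in Homeo₊(I), equipped with a marking witnessing fastness. Suppose x₀, x₁ ∈ I, that for i = 0,1 the word u_i is locally reduced at x_i with x_i ∉ src(u_i), that |u₀| ≤ |u₁|, and that x₀u₀ = x₁u₁. Then u₀ is a suffix of u₁ (u₁ = wu₀ for some word w). In particular, if t ∈ I lies in no foot of any element of A and u, v are words locally reduced at t with tu = tv, then u = v. -/

import Mathlib

open Set

/-- The unit interval `[0,1]` as a type. -/
abbrev UI : Type := ↥unitInterval

/-- Bijections of the unit interval; orientation-preserving homeomorphisms are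
exactly the monotone ones among these. -/
abbrev Homeo01 : Type := Equiv.Perm UI

namespace PingPong

/-- The support of `f`. -/
def supt (f : Homeo01) : Set UI := {t | f t ≠ t}

/-- `f` is an orientation-preserving homeomorphism of `[0,1]`:
a monotone bijection of `[0,1]` (automatically a homeomorphism). -/
def IsOPH (f : Homeo01) : Prop := Monotone ⇑f

/-- A bump function: an orientation preserving homeomorphism with exactly one
orbital, i.e. whose support is nonempty and connected. -/
def IsBump (f : Homeo01) : Prop := IsOPH f ∧ IsConnected (supt f)

/-- A positive bump function. -/
def IsPosBump (f : Homeo01) : Prop := IsBump f ∧ ∀ t ∈ supt f, t < f t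

/-- The source of a positive bump `a` with marker `t`. -/
def src (a : Homeo01) (t : UI) : Set UI := {s ∈ supt a | s < t}

/-- The destination of a positive bump `a` with marker `t`. -/
def dest (a : Homeo01) (t : UI) : Set UI := {s ∈ supt a | a t ≤ s}

/-- `m` is a marking of the collection `A` of bumps. -/
def IsMarking (A : Set Homeo01) (m : Homeo01 → UI) : Prop := ∀ a ∈ A, m a ∈ supt a

/-- The feet of a marked bump: `false` gives the source, `true` the destination. -/
def foot (a : Homeo01) (t : UI) : Bool → Set UI
  | false => src a t
  | true => dest a t

/-- The feet of the marked family `(A, m)` are pairwise disjoint. -/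
def FeetDisjoint (A : Set Homeo01) (m : Homeo01 → UI) : Prop :=
  ∀ a ∈ A, ∀ b ∈ A, ∀ i j : Bool, (a, i) ≠ (b, j) →
    Disjoint (foot a (m a) i) (foot b (m b) j)

/-- A geometrically fast collection of (positive) bumps. -/
def FastBumps (A : Set Homeo01) : Prop :=
  (∀ a ∈ A, IsPosBump a) ∧ ∃ m : Homeo01 → UI, IsMarking A m ∧ FeetDisjoint A m

/-- `t` is a left transition point of `f`. -/
def IsLeftTransition (f : Homeo01) (t : UI) : Prop :=
  t ∉ supt f ∧ ∀ ε : ℝ, 0 < ε → ∃ s ∈ supt f, t < s ∧ (s : ℝ) < (t : ℝ) + ε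

/-- `t` is a right transition point of `f`. -/
def IsRightTransition (f : Homeo01) (t : UI) : Prop :=
  t ∉ supt f ∧ ∀ ε : ℝ, 0 < ε → ∃ s ∈ supt f, s < t ∧ (t : ℝ) - ε < (s : ℝ)

/-- `t` is a transition point of `f`. -/
def IsTransition (f : Homeo01) (t : UI) : Prop :=
  IsLeftTransition f t ∨ IsRightTransition f t

/-- A geometrically proper set of homeomorphisms. -/
def GeomProper (X : Set Homeo01) : Prop :=
  (∀ f ∈ X, ∀ g ∈ X, f ≠ g → ∀ t : UI, ¬(IsLeftTransition f t ∧ IsLeftTransition g t)) ∧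
  (∀ f ∈ X, ∀ g ∈ X, f ≠ g → ∀ t : UI, ¬(IsRightTransition f t ∧ IsRightTransition g t))

/-- The positive bump `a` is used in `f`. -/
def UsedIn (f a : Homeo01) : Prop :=
  IsPosBump a ∧ (Set.EqOn ⇑f ⇑a (supt a) ∨ Set.EqOn ⇑f ⇑a⁻¹ (supt a))

/-- The set of (positive) bumps used in `X`. -/
def usedBumps (X : Set Homeo01) : Set Homeo01 := {a | ∃ f ∈ X, UsedIn f a}

/-- A geometrically fast set of homeomorphisms. -/
def GeomFast (X : Set Homeo01) : Prop := GeomProper X ∧ FastBumps (usedBumps X)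

/-- The set of transition points of elements of `X`. -/
def transitionPoints (X : Set Homeo01) : Set UI := {t | ∃ f ∈ X, IsTransition f t}

/-! ### Words -/

/-- A word in the alphabet `A^± = A ∪ A⁻¹`, recorded as a list of the permutations
represented by its symbols (for a set `A` of positive bumps this is faithful,
since `A ∩ A⁻¹ = ∅`). -/
def WordOn (A : Set Homeo01) (w : List Homeo01) : Prop := ∀ x ∈ w, x ∈ A ∨ x⁻¹ ∈ A

/-- A freely reduced word: no symbol is immediately followed by its inverse. -/
def FreelyReduced (w : List Homeo01) : Prop := List.Chain' (fun a b => b ≠ a⁻¹) w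

/-- The right action of a word on a point: apply the symbols from left to right. -/
def act (t : UI) (w : List Homeo01) : UI := w.foldl (fun s a => a s) t

/-- `w` is locally reduced at `t`. -/
def LocallyReducedAt (w : List Homeo01) (t : UI) : Prop :=
  FreelyReduced w ∧ ∀ (u : List Homeo01) (a : Homeo01), u ++ [a] <+: w → a (act t u) ≠ act t u

open Classical in
/-- The source of a symbol of `A^±`: for `a ∈ A` it is `src a`, and for the
formal inverse of an element of `A` it is the destination of that element. -/
noncomputable def symSrc (A : Set Homeo01) (m : Homeo01 → UI) (b : Homeo01) : Set UI :=
  if b ∈ A then src b (m b) else dest b⁻¹ (m b⁻¹)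

open Classical in
/-- The destination of a symbol of `A^±`. -/
noncomputable def symDest (A : Set Homeo01) (m : Homeo01 → UI) (b : Homeo01) : Set UI :=
  if b ∈ A then dest b (m b) else src b⁻¹ (m b⁻¹)

/-- The source of a word: the source of its first symbol (empty for the empty word). -/
noncomputable def wordSrc (A : Set Homeo01) (m : Homeo01 → UI) : List Homeo01 → Set UI
  | [] => ∅
  | a :: _ => symSrc A m a

/-- The destination of a word: the destination of its last symbol. -/
noncomputable def wordDest (A : Set Homeo01) (m : Homeo01 → UI) (w : List Homeo01) : Set UI :=
  match w.getLast? with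
  | none => ∅
  | some a => symDest A m a

/-- `J(w) = supt(a) \ src(a)` where `a` is the first symbol of `w`. -/
noncomputable def Jset (A : Set Homeo01) (m : Homeo01 → UI) : List Homeo01 → Set UI
  | [] => ∅
  | a :: _ => supt a \ symSrc A m a

/-- `t` has trivial history: it lies in no foot of any element of `A`. -/
def TrivialHistory (A : Set Homeo01) (m : Homeo01 → UI) (t : UI) : Prop :=
  ∀ a ∈ A, t ∉ src a (m a) ∧ t ∉ dest a (m a)

/-- `x` has finite history: there is a finite bound on the lengths of `A`-words
locally reduced at `x` whose evaluation at `x` is outside their destination. -/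
def FiniteHistory (A : Set Homeo01) (m : Homeo01 → UI) (x : UI) : Prop :=
  ∃ n : ℕ, ∀ w : List Homeo01, WordOn A w → LocallyReducedAt w x →
    act x w ∉ wordDest A m w → w.length ≤ n

/-- A return word for `x`. -/
def IsReturnWord (x : UI) (w : List Homeo01) : Prop := w ≠ [] ∧ act x w = x

/-- `w` has a return prefix for `x`. -/
def HasReturnPrefix (x : UI) (w : List Homeo01) : Prop :=
  ∃ v : List Homeo01, v <+: w ∧ IsReturnWord x v

/-- The set of initial markers of the marked family `(A, m)`. -/
def initialMarkers (A : Set Homeo01) (m : Homeo01 → UI) : Set UI :=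
  {t | (∃ a ∈ A, m a = t) ∧ ∀ b ∈ A, m b < t → b (m b) ≠ t}

/-- `M⟨X⟩`: the orbit of the set of initial markers of `(A, m)` under the group
generated by `X`. -/
def MOrbit (A : Set Homeo01) (m : Homeo01 → UI) (X : Set Homeo01) : Set UI :=
  {u | ∃ t ∈ initialMarkers A m, ∃ g ∈ Subgroup.closure X, g t = u}

end PingPong
namespace PingPong

/-! ### Piecewise linear maps and Thompson's group F -/

/-- `f` is piecewise linear (finitely many affine pieces). -/
def IsPL (f : Homeo01) : Prop :=
  ∃ (n : ℕ) (t : Fin (n + 1) → ℝ), StrictMono t ∧ t 0 = 0 ∧ t (Fin.last n) = 1 ∧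
    ∀ i : Fin n, ∃ c d : ℝ, ∀ s : UI,
      t i.castSucc ≤ (s : ℝ) → (s : ℝ) ≤ t i.succ → ((f s : ℝ)) = c * (s : ℝ) + d

/-- `x` is a dyadic rational. -/
def IsDyadic (x : ℝ) : Prop := ∃ (a : ℤ) (k : ℕ), x = (a : ℝ) / 2 ^ k

/-- `f` belongs to Thompson's group `F`: an orientation-preserving piecewise linear
homeomorphism of `[0,1]` with dyadic breakpoints and slopes integer powers of `2`. -/
def InThompsonF (f : Homeo01) : Prop :=
  IsOPH f ∧
  ∃ (n : ℕ) (t : Fin (n + 1) → ℝ), StrictMono t ∧ t 0 = 0 ∧ t (Fin.last n) = 1 ∧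
    (∀ i, IsDyadic (t i)) ∧
    ∀ i : Fin n, ∃ (k : ℤ) (d : ℝ), ∀ s : UI,
      t i.castSucc ≤ (s : ℝ) → (s : ℝ) ≤ t i.succ → ((f s : ℝ)) = (2 : ℝ) ^ k * (s : ℝ) + d

/-! ### Stretched transition chains -/

/-- `a` is isolated in `A`: its support contains no transition point of an element of `A`. -/
def IsolatedIn (A : Set Homeo01) (a : Homeo01) : Prop :=
  ∀ t ∈ supt a, ∀ b ∈ A, ¬ IsTransition b t

/-- `c` (with supports `(x i, y i)`) is a stretched transition chain of `A`. -/
def IsSTC (A : Set Homeo01) (k : ℕ) (c : Fin (k + 1) → Homeo01)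
    (x y : Fin (k + 1) → ℝ) : Prop :=
  (∀ i, c i ∈ A ∧ ¬ IsolatedIn A (c i)) ∧
  (∀ i, supt (c i) = {t : UI | x i < (t : ℝ) ∧ (t : ℝ) < y i}) ∧
  (∀ i : Fin k, x i.castSucc < x i.succ ∧ x i.succ < y i.castSucc ∧ y i.castSucc < y i.succ) ∧
  (∀ i : Fin k, ∀ t : UI, x i.succ < (t : ℝ) → (t : ℝ) < y i.castSucc →
    ∀ b ∈ A, ¬ IsTransition b t)

/-- `S` is the underlying set of some stretched transition chain of `A`. -/
def ChainSet (A : Set Homeo01) (S : Set Homeo01) : Prop :=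
  ∃ (k : ℕ) (c : Fin (k + 1) → Homeo01) (x y : Fin (k + 1) → ℝ),
    IsSTC A k c x y ∧ S = Set.range c

/-- `S` is the underlying set of a maximal stretched transition chain of `A`. -/
def MaxChainSet (A : Set Homeo01) (S : Set Homeo01) : Prop :=
  ChainSet A S ∧ ∀ S' : Set Homeo01, ChainSet A S' → S ⊆ S' → S = S'

/-- The transition points of `A` lying in the support of the chain `c`. -/
def chainTrans (A : Set Homeo01) (k : ℕ) (c : Fin (k + 1) → Homeo01) : Set UI :=
  {t | (∃ i, t ∈ supt (c i)) ∧ ∃ b ∈ A, IsTransition b t}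

/-- The image of `t` under the composition `∏ C = c 0 ⋯ c k`. -/
def chainApply (k : ℕ) (c : Fin (k + 1) → Homeo01) (t : UI) : UI :=
  (List.ofFn c).foldl (fun s a => a s) t

/-! ### Dynamical diagrams -/

/-- The collection of feet of the bumps used in `X`, with marking `m`. -/
def Feet (X : Set Homeo01) (m : Homeo01 → UI) : Set (Set UI) :=
  {S | ∃ a ∈ usedBumps X, S = src a (m a) ∨ S = dest a (m a)}

/-- The signed bumps of `f`: bumps agreeing with `f` on their support. -/
def signedBumps (f : Homeo01) : Set Homeo01 :=
  {b | IsBump b ∧ Set.EqOn ⇑b ⇑f (supt b)}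

open Classical in
/-- The source of a signed bump, with respect to the marking `m` of the positive bumps. -/
noncomputable def sSrc (m : Homeo01 → UI) (b : Homeo01) : Set UI :=
  if IsPosBump b then src b (m b) else dest b⁻¹ (m b⁻¹)

open Classical in
/-- The destination of a signed bump, with respect to the marking `m` of the positive bumps. -/
noncomputable def sDest (m : Homeo01 → UI) (b : Homeo01) : Set UI :=
  if IsPosBump b then dest b (m b) else src b⁻¹ (m b⁻¹)

/-- An isomorphism of the dynamical diagrams of the marked families `(X, mX)` and
`(Y, mY)`, inducing the bijection `τ : X → Y`: an order-preserving bijection `Φ`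
between the collections of feet, together with, for each `f ∈ X`, a bijection of the
signed bumps of `f` with those of `τ f` under which `Φ` matches sources with sources
and destinations with destinations. -/
def DiagIso (X : Set Homeo01) (mX : Homeo01 → UI) (Y : Set Homeo01) (mY : Homeo01 → UI)
    (τ : Homeo01 → Homeo01) : Prop :=
  Set.BijOn τ X Y ∧
  ∃ Φ : Set UI → Set UI,
    Set.BijOn Φ (Feet X mX) (Feet Y mY) ∧
    (∀ S ∈ Feet X mX, ∀ T ∈ Feet X mX,
      (∀ s ∈ S, ∀ t ∈ T, s < t) → ∀ s ∈ Φ S, ∀ t ∈ Φ T, s < t) ∧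
    ∀ f ∈ X, ∃ β : Homeo01 → Homeo01,
      Set.BijOn β (signedBumps f) (signedBumps (τ f)) ∧
      ∀ b ∈ signedBumps f, Φ (sSrc mX b) = sSrc mY (β b) ∧ Φ (sDest mX b) = sDest mY (β b)

/-! ### Excision -/

/-- The union of the supports of the bumps of `E` used in `f`. -/
def quotSupp (f : Homeo01) (E : Set Homeo01) : Set UI :=
  {t | ∃ a ∈ E, UsedIn f a ∧ t ∈ supt a}

/-- `g = f/E`: `g` is the identity on the supports of the bumps of `E` used in `f`,
and agrees with `f` elsewhere. -/
def IsQuot (f : Homeo01) (E : Set Homeo01) (g : Homeo01) : Prop :=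
  (∀ t ∈ quotSupp f E, g t = t) ∧ ∀ t ∉ quotSupp f E, g t = f t

/-- `E` is extraneous in `X` (with respect to the marking `m`), witnessed by an
interval `J`. -/
def Extraneous (X : Set Homeo01) (m : Homeo01 → UI) (E : Set Homeo01) : Prop :=
  ∃ J : Set UI, J.OrdConnected ∧ ∃ f ∈ X,
    (∀ e ∈ E, UsedIn f e ∧ IsolatedIn (usedBumps X) e ∧ supt e ⊆ J) ∧
    (∃ a : Homeo01, UsedIn f a ∧ a ∉ E ∧ (src a (m a) ⊆ J ∨ dest a (m a) ⊆ J)) ∧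
    ∀ g ∈ X, g ≠ f → ∀ b : Homeo01, UsedIn g b →
      Disjoint (src b (m b)) J ∧ Disjoint (dest b (m b)) J

end PingPong
namespace PingPong

section Collision

variable {A : Set Homeo01} {m : Homeo01 → UI}

theorem IsOPH.strictMono {f : Homeo01} (hf : IsOPH f) : StrictMono f :=
  Monotone.strictMono_of_injective hf f.injective

theorem apply_mem_supt {f : Homeo01} {s : UI} (hs : s ∈ supt f) : f s ∈ supt f :=
  fun h => hs (f.injective h)

theorem mem_supt_inv {f : Homeo01} {s : UI} : s ∈ supt f⁻¹ ↔ s ∈ supt f :=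
  not_congr (Equiv.Perm.inv_eq_iff_eq.trans eq_comm)

theorem inv_notMem (hA : ∀ a ∈ A, IsPosBump a) {a : Homeo01} (ha : a ∈ A) : a⁻¹ ∉ A := by
  intro ha'
  obtain ⟨s, hs⟩ := (hA a ha).1.2.nonempty
  have h := (hA _ ha').2 (a s) (mem_supt_inv.2 (apply_mem_supt hs))
  rw [Equiv.Perm.inv_eq_iff_eq.2 rfl] at h
  exact lt_asymm h ((hA a ha).2 s hs)

theorem symDest_inv (hA : ∀ a ∈ A, IsPosBump a) {b : Homeo01} (hb : b ∈ A ∨ b⁻¹ ∈ A) :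
    symDest A m b⁻¹ = symSrc A m b := by
  by_cases h : b ∈ A
  · simp [symDest, symSrc, h, inv_notMem hA h]
  · simp [symDest, symSrc, h, hb.resolve_left h]

/-- A symbol of `A^±` moves the points of its support outside its source into its
destination. -/
theorem apply_mem_symDest (hA : ∀ a ∈ A, IsPosBump a) {b : Homeo01} (hb : b ∈ A ∨ b⁻¹ ∈ A)
    {s : UI} (hs : b s ≠ s) (hsrc : s ∉ symSrc A m b) : b s ∈ symDest A m b := by
  by_cases h : b ∈ A
  · simp only [symDest, symSrc, h, if_true] at hsrc ⊢
    exact ⟨apply_mem_supt hs, (hA b h).1.1 (not_lt.1 fun hlt => hsrc ⟨hs, hlt⟩)⟩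
  · have hb' := hb.resolve_left h
    simp only [symDest, symSrc, h, if_false] at hsrc ⊢
    have hs' : s ∈ supt b⁻¹ := mem_supt_inv.2 hs
    refine ⟨mem_supt_inv.2 (apply_mem_supt (f := b) hs), ?_⟩
    have hlt : s < b⁻¹ (m b⁻¹) := not_le.1 fun hle => hsrc ⟨hs', hle⟩
    rw [← (hA _ hb').1.1.strictMono.lt_iff_lt, Equiv.Perm.inv_eq_iff_eq.2 rfl]
    exact hlt

/-- Distinct symbols of `A^±` have disjoint destinations. -/
theorem eq_of_mem_symDest (hfd : FeetDisjoint A m) {a b : Homeo01} (ha : a ∈ A ∨ a⁻¹ ∈ A)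
    (hb : b ∈ A ∨ b⁻¹ ∈ A) {s : UI} (hsa : s ∈ symDest A m a) (hsb : s ∈ symDest A m b) :
    a = b := by
  have key : ∀ c ∈ A, ∀ d ∈ A, ∀ i j, s ∈ foot c (m c) i → s ∈ foot d (m d) j →
      c = d ∧ i = j := by
    intro c hc d hd i j hsc hsd
    by_contra hne
    exact Set.disjoint_left.1 (hfd c hc d hd i j fun h => hne (Prod.mk.inj h)) hsc hsd
  by_cases h : a ∈ A <;> by_cases h' : b ∈ A <;>
    simp only [symDest, h, h', if_true, if_false] at hsa hsb
  · exact (key a h b h' true true hsa hsb).1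
  · cases (key a h _ (hb.resolve_left h') true false hsa hsb).2
  · cases (key _ (ha.resolve_left h) b h' false true hsa hsb).2
  · exact inv_injective (key _ (ha.resolve_left h) _ (hb.resolve_left h') false false hsa hsb).1

theorem act_append (t : UI) (u v : List Homeo01) : act t (u ++ v) = act (act t u) v :=
  List.foldl_append

theorem act_injective (u : List Homeo01) : Function.Injective fun t => act t u := by
  induction u with
  | nil => exact fun _ _ h => h
  | cons a u ih => exact fun s t h => a.injective (ih h)

theorem LocallyReducedAt.of_append {u v : List Homeo01} {x : UI}
    (h : LocallyReducedAt (u ++ v) x) : LocallyReducedAt u x :=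
  ⟨(List.isChain_append.1 h.1).1, fun w a hw => h.2 w a (hw.trans (List.prefix_append u v))⟩

theorem notMem_wordSrc_of_append {u v : List Homeo01} {x : UI}
    (h : x ∉ wordSrc A m (u ++ v)) : x ∉ wordSrc A m u := by
  cases u with
  | nil => exact Set.notMem_empty x
  | cons a u => exact h

/-- A word locally reduced at a point outside its source carries that point into the
destination of its last symbol. -/
theorem act_mem_symDest (hA : ∀ a ∈ A, IsPosBump a) (hfd : FeetDisjoint A m) {x : UI}
    (v : List Homeo01) : ∀ a : Homeo01, WordOn A (v ++ [a]) → LocallyReducedAt (v ++ [a]) x →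
      x ∉ wordSrc A m (v ++ [a]) → act x (v ++ [a]) ∈ symDest A m a := by
  induction v using List.reverseRecOn with
  | nil =>
    intro a hw hl hx
    exact apply_mem_symDest hA (hw a (by simp)) (hl.2 [] a List.prefix_rfl) hx
  | append_singleton v c ih =>
    intro a hw hl hx
    have hc := ih c (fun y hy => hw y (List.mem_append_left _ hy)) hl.of_append
      (notMem_wordSrc_of_append hx)
    have ha := hw a (by simp)
    have hac : a ≠ c⁻¹ :=
      (List.isChain_append.1 hl.1).2.2 c (by simp) a (by simp)
    rw [act_append]
    refine apply_mem_symDest hA ha (hl.2 _ a List.prefix_rfl) fun hsrc => hac ?_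
    rw [← symDest_inv hA ha] at hsrc
    have ha' : a⁻¹ ∈ A ∨ a⁻¹⁻¹ ∈ A := by rw [inv_inv]; exact ha.symm
    rw [← eq_of_mem_symDest hfd ha' (hw c (by simp)) hsrc hc, inv_inv]

theorem isSuffix_of_act_eq (hA : ∀ a ∈ A, IsPosBump a) (hfd : FeetDisjoint A m) {x₀ x₁ : UI}
    (u₀ : List Homeo01) : ∀ u₁ : List Homeo01, WordOn A u₀ → WordOn A u₁ →
      LocallyReducedAt u₀ x₀ → LocallyReducedAt u₁ x₁ →
      x₀ ∉ wordSrc A m u₀ → x₁ ∉ wordSrc A m u₁ →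
      u₀.length ≤ u₁.length → act x₀ u₀ = act x₁ u₁ → u₀ <:+ u₁ := by
  induction u₀ using List.reverseRecOn with
  | nil => exact fun u₁ _ _ _ _ _ _ _ _ => List.nil_suffix
  | append_singleton v₀ a ih =>
    intro u₁ hw₀ hw₁ hl₀ hl₁ hx₀ hx₁ hlen hact
    obtain rfl | ⟨v₁, b, rfl⟩ := List.eq_nil_or_concat' u₁
    · simp at hlen
    have h₀ := act_mem_symDest hA hfd v₀ a hw₀ hl₀ hx₀
    have h₁ := act_mem_symDest hA hfd v₁ b hw₁ hl₁ hx₁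
    rw [← hact] at h₁
    obtain rfl := eq_of_mem_symDest hfd (hw₀ a (by simp)) (hw₁ b (by simp)) h₀ h₁
    rw [act_append, act_append] at hact
    obtain ⟨w, rfl⟩ := ih v₁ (fun y hy => hw₀ y (List.mem_append_left _ hy))
      (fun y hy => hw₁ y (List.mem_append_left _ hy)) hl₀.of_append hl₁.of_append
      (notMem_wordSrc_of_append hx₀) (notMem_wordSrc_of_append hx₁)
      (by simpa using hlen) (act_injective [a] hact)
    exact ⟨w, by simp⟩

theorem notMem_symSrc_of_trivialHistory {t : UI} (ht : TrivialHistory A m t) {b : Homeo01}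
    (hb : b ∈ A ∨ b⁻¹ ∈ A) : t ∉ symSrc A m b := by
  by_cases h : b ∈ A
  · simpa [symSrc, h] using (ht b h).1
  · simpa [symSrc, h] using (ht _ (hb.resolve_left h)).2

theorem notMem_symDest_of_trivialHistory {t : UI} (ht : TrivialHistory A m t) {b : Homeo01}
    (hb : b ∈ A ∨ b⁻¹ ∈ A) : t ∉ symDest A m b := by
  by_cases h : b ∈ A
  · simpa [symDest, h] using (ht b h).2
  · simpa [symDest, h] using (ht _ (hb.resolve_left h)).1

theorem notMem_wordSrc_of_trivialHistory {t : UI} (ht : TrivialHistory A m t)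
    {u : List Homeo01} (hu : WordOn A u) : t ∉ wordSrc A m u := by
  cases u with
  | nil => exact Set.notMem_empty t
  | cons a u => exact notMem_symSrc_of_trivialHistory ht (hu a (by simp))

theorem eq_of_act_eq_of_length_le (hA : ∀ a ∈ A, IsPosBump a) (hfd : FeetDisjoint A m) {t : UI}
    (ht : TrivialHistory A m t) {u v : List Homeo01} (hu : WordOn A u) (hv : WordOn A v)
    (hlu : LocallyReducedAt u t) (hlv : LocallyReducedAt v t) (hlen : u.length ≤ v.length)
    (hact : act t u = act t v) : u = v := by
  have hsv := notMem_wordSrc_of_trivialHistory ht hv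
  obtain ⟨w, rfl⟩ := isSuffix_of_act_eq hA hfd u v hu hv hlu hlv
    (notMem_wordSrc_of_trivialHistory ht hu) hsv hlen hact
  obtain rfl | ⟨w, b, rfl⟩ := List.eq_nil_or_concat' w
  · rfl
  rw [act_append] at hact
  have hmem := act_mem_symDest hA hfd w b (fun y hy => hv y (List.mem_append_left _ hy))
    hlv.of_append (notMem_wordSrc_of_append hsv)
  rw [← act_injective u hact] at hmem
  exact absurd hmem (notMem_symDest_of_trivialHistory ht (hv b (by simp)))

end Collision

/-- **Lemma (Collision).** For a geometrically fast marked set `A` of positive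
bumps: if `u₀, u₁` are `A`-words locally reduced at `x₀, x₁` respectively with
`xᵢ ∉ src(uᵢ)`, `|u₀| ≤ |u₁|` and `x₀u₀ = x₁u₁`, then `u₀` is a suffix of `u₁`.
In particular, if `t` lies in no foot of any element of `A` and `u, v` are `A`-words
locally reduced at `t` with `tu = tv`, then `u = v`. -/
theorem collision (A : Set Homeo01) (m : Homeo01 → UI)
    (hA : ∀ a ∈ A, IsPosBump a) (hm : IsMarking A m) (hfd : FeetDisjoint A m) :
    (∀ (x₀ x₁ : UI) (u₀ u₁ : List Homeo01),
      WordOn A u₀ → WordOn A u₁ →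
      LocallyReducedAt u₀ x₀ → LocallyReducedAt u₁ x₁ →
      x₀ ∉ wordSrc A m u₀ → x₁ ∉ wordSrc A m u₁ →
      u₀.length ≤ u₁.length → act x₀ u₀ = act x₁ u₁ →
      ∃ w : List Homeo01, u₁ = w ++ u₀) ∧
    (∀ t : UI, (∀ a ∈ A, t ∉ src a (m a) ∧ t ∉ dest a (m a)) →
      ∀ u v : List Homeo01, WordOn A u → WordOn A v →
        LocallyReducedAt u t → LocallyReducedAt v t →
        act t u = act t v → u = v) := by
  refine ⟨fun x₀ x₁ u₀ u₁ hw₀ hw₁ hl₀ hl₁ hx₀ hx₁ hlen hact => ?_,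
    fun t ht u v hu hv hlu hlv hact => ?_⟩
  · obtain ⟨w, hw⟩ := isSuffix_of_act_eq hA hfd u₀ u₁ hw₀ hw₁ hl₀ hl₁ hx₀ hx₁ hlen hact
    exact ⟨w, hw.symm⟩
  · obtain hlen | hlen := le_total u.length v.length
    · exact eq_of_act_eq_of_length_le hA hfd ht hu hv hlu hlv hlen hact
    · exact (eq_of_act_eq_of_length_le hA hfd ht hv hu hlv hlu hlen hact.symm).symm

end PingPong
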